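/- arXiv:1405.1352 — 7 statements merged into one kernel-verified Lean document; each statement's English description precedes it below -/
import Mathlib

section
/- Let a > 0, let X be a positive real random variable whose cumulative distribution function t ↦ P(X ≤ t) is continuous on [0,a), and let U be uniformly distributed on (0,1) and independent of X. Define X̃ = X·1_{X<a} + (a/U)·1_{X≥a}. Then: (i) the cumulative distribution function t ↦ P(X̃ ≤ t) is continuous on all of ℝ; (ii) for every z ∈ [0,a), the events {X̃ ≤ z} and {X ≤ z} coincide almost surely, and, whenever P(X > z) > 0, for every Borel set B ⊆ (z,a) one has P(X̃ ∈ B | X̃ > z) = P(X ∈ B | X > z); (iii) the events {X̃ ≥ a} and {X ≥ a} coincide almost surely, so in particular P(X̃ ≥ a) = P(X ≥ a). -/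
open MeasureTheory ProbabilityTheory

lemma atom_eq {Ω : Type*} [MeasurableSpace Ω] (μ : Measure Ω) [IsProbabilityMeasure μ]
    (Y : Ω → ℝ) (hY : Measurable Y) :
    (∀ t, cdf (μ.map Y) t = (μ {ω | Y ω ≤ t}).toReal) ∧
    ∀ t, (μ {ω | Y ω = t} = 0 ↔ ContinuousAt (fun t => (μ {ω | Y ω ≤ t}).toReal) t) := by
  haveI : IsProbabilityMeasure (μ.map Y) := Measure.isProbabilityMeasure_map hY.aemeasurable
  have h1 : ∀ t, cdf (μ.map Y) t = (μ {ω | Y ω ≤ t}).toReal := by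
    intro t
    rw [cdf_eq_real, Measure.real, Measure.map_apply hY measurableSet_Iic]
    rfl
  refine ⟨h1, fun t => ?_⟩
  have h2 : (fun t => (μ {ω | Y ω ≤ t}).toReal) = cdf (μ.map Y) := by
    ext t; exact (h1 t).symm
  have h3 : μ {ω | Y ω = t} = (cdf (μ.map Y)).measure {t} := by
    rw [measure_cdf, Measure.map_apply hY (measurableSet_singleton t)]
    rfl
  have hm := monotone_cdf (μ.map Y)
  rw [h2, h3, StieltjesFunction.measure_singleton, ENNReal.ofReal_eq_zero,
    hm.continuousAt_iff_leftLim_eq_rightLim, StieltjesFunction.rightLim_eq]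
  have := hm.leftLim_le (le_refl t)
  constructor
  · intro h; linarith
  · intro h; linarith

/-- Reduction of Assumption (continuity of the CDF on `[0,a)`) to full
continuity, via the auxiliary random variable `X̃ = X·1_{X<a} + (a/U)·1_{X≥a}`. -/
theorem stmt_0
    {Ω : Type*} [MeasurableSpace Ω] (μ : Measure Ω) [IsProbabilityMeasure μ]
    (a : ℝ) (ha : 0 < a)
    (X U : Ω → ℝ) (hX : Measurable X) (hU : Measurable U)
    (hXpos : ∀ᵐ ω ∂μ, 0 < X ω)
    (hcont : ContinuousOn (fun t => (μ {ω | X ω ≤ t}).toReal) (Set.Ico 0 a))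
    (hUlaw : Measure.map U μ = volume.restrict (Set.Ioo (0 : ℝ) 1))
    (hindep : IndepFun X U μ)
    (Xt : Ω → ℝ) (hXt : ∀ ω, Xt ω = if X ω < a then X ω else a / U ω) :
    -- (i) the CDF of X̃ is continuous on all of ℝ
    Continuous (fun t => (μ {ω | Xt ω ≤ t}).toReal)
    -- (ii)
    ∧ (∀ z ∈ Set.Ico (0 : ℝ) a,
        ({ω | Xt ω ≤ z} : Set Ω) =ᵐ[μ] ({ω | X ω ≤ z} : Set Ω)
        ∧ (0 < μ {ω | z < X ω} →
            ∀ B : Set ℝ, B ⊆ Set.Ioo z a → MeasurableSet B →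
              μ[|{ω | z < Xt ω}] {ω | Xt ω ∈ B} = μ[|{ω | z < X ω}] {ω | X ω ∈ B}))
    -- (iii)
    ∧ (({ω | a ≤ Xt ω} : Set Ω) =ᵐ[μ] ({ω | a ≤ X ω} : Set Ω)
        ∧ μ {ω | a ≤ Xt ω} = μ {ω | a ≤ X ω}) := by
  have hU01 : ∀ᵐ ω ∂μ, U ω ∈ Set.Ioo (0 : ℝ) 1 := by
    apply ae_of_ae_map hU.aemeasurable
    rw [hUlaw]
    exact ae_restrict_mem measurableSet_Ioo
  have hXtm : Measurable Xt := by
    have : Xt = fun ω => if X ω < a then X ω else a / U ω := funext hXt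
    rw [this]
    exact Measurable.ite (measurableSet_lt hX measurable_const) hX (measurable_const.div hU)
  have hUatom : ∀ c, μ {ω | U ω = c} = 0 := by
    intro c
    have : μ {ω | U ω = c} = μ.map U {c} := by
      rw [Measure.map_apply hU (measurableSet_singleton c)]; rfl
    rw [this, hUlaw]
    simp
  have hkey : ∀ᵐ ω ∂μ, (X ω < a ∧ Xt ω = X ω) ∨ (a ≤ X ω ∧ a < Xt ω) := by
    filter_upwards [hU01] with ω h
    rw [hXt ω]
    by_cases hx : X ω < a
    · left; simp [hx]
    · right
      rw [if_neg hx]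
      refine ⟨not_lt.1 hx, ?_⟩
      rw [lt_div_iff₀ h.1]
      nlinarith [h.2]
  refine ⟨?_, ?_, ?_⟩
  · rw [continuous_iff_continuousAt]
    intro t
    rw [← (atom_eq μ Xt hXtm).2 t]
    have hA : μ {ω | X ω = t ∧ X ω < a} = 0 := by
      by_cases ht0 : t ≤ 0
      · refine measure_mono_null ?_ (ae_iff.1 hXpos)
        intro ω hω
        have := hω.1
        simp only [Set.mem_setOf_eq]
        linarith
      by_cases hta : t < a
      · refine measure_mono_null (t := {ω | X ω = t}) (fun ω hω => hω.1) ?_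
        rw [(atom_eq μ X hX).2 t]
        exact hcont.continuousAt (Ico_mem_nhds (not_le.1 ht0) hta)
      · convert measure_empty (μ := μ)
        ext ω
        simp only [Set.mem_setOf_eq, Set.mem_empty_iff_false, iff_false]
        rintro ⟨h1, h2⟩
        exact hta (h1 ▸ h2)
    refine measure_mono_null ?_ (measure_union_null hA (hUatom (a / t)))
    intro ω hω
    have hww : Xt ω = t := hω
    rw [hXt ω] at hww
    by_cases hx : X ω < a
    · left; rw [if_pos hx] at hww; exact ⟨hww, hx⟩
    · right; rw [if_neg hx] at hww
      change U ω = a / t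
      rw [← hww, div_div_cancel₀ ha.ne']
  · intro z hz
    refine ⟨?_, ?_⟩
    · filter_upwards [hkey] with ω h
      apply propext
      change Xt ω ≤ z ↔ X ω ≤ z
      rcases h with ⟨_, h⟩ | ⟨h1, h2⟩
      · rw [h]
      · constructor <;> intro h <;> linarith [hz.2]
    · intro _ B hB hBm
      rw [cond_apply (measurableSet_lt measurable_const hXtm),
        cond_apply (measurableSet_lt measurable_const hX)]
      congr 1
      · congr 1
        apply measure_congr
        filter_upwards [hkey] with ω h
        apply propext
        change z < Xt ω ↔ z < X ω
        rcases h with ⟨_, h⟩ | ⟨h1, h2⟩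
        · rw [h]
        · constructor <;> intro h <;> linarith [hz.2]
      · apply measure_congr
        filter_upwards [hkey] with ω h
        apply propext
        change (z < Xt ω ∧ Xt ω ∈ B) ↔ (z < X ω ∧ X ω ∈ B)
        rcases h with ⟨_, h⟩ | ⟨h1, h2⟩
        · rw [h]
        · constructor
          · rintro ⟨_, h⟩; linarith [(hB h).2]
          · rintro ⟨_, h⟩; linarith [(hB h).2]
  · have h3 : ({ω | a ≤ Xt ω} : Set Ω) =ᵐ[μ] ({ω | a ≤ X ω} : Set Ω) := by
      filter_upwards [hkey] with ω h
      apply propext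
      change a ≤ Xt ω ↔ a ≤ X ω
      rcases h with ⟨_, h⟩ | ⟨h1, h2⟩
      · rw [h]
      · exact ⟨fun _ => h1, fun _ => h2.le⟩
    exact ⟨h3, measure_congr h3⟩
end

section
/- Let n, k be integers with 1 ≤ k ≤ n−1, let a > 0, and let θ : [0,a] → ℝ be a bounded measurable function. Then there exists at most one bounded measurable function q : [0,a] → [0,∞) satisfying, for all x ∈ [0,a], q(x) = (1 − k/n) ∫_x^a q(y) f_{n,k}(y;x) dy + θ(x). -/
open MeasureTheory

/-- Conditional cumulative distribution function `F(y;x) = (F(y) − F(x))/(1 − F(x))`. -/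
noncomputable def condCDF' (F : ℝ → ℝ) (x y : ℝ) : ℝ := (F y - F x) / (1 - F x)

/-- Density `f_{n,k}(y;x)` of the `k`-th order statistic of an `n`-sample of `L(X | X > x)`:
`f_{n,k}(y;x) = k·binom(n,k)·F(y;x)^{k−1}·(f(y)/(1−F(x)))·(1−F(y;x))^{n−k}`. -/
noncomputable def orderPDF (f F : ℝ → ℝ) (n k : ℕ) (x y : ℝ) : ℝ :=
  (k : ℝ) * (n.choose k) * condCDF' F x y ^ (k - 1) * (f y / (1 - F x))
    * (1 - condCDF' F x y) ^ (n - k)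

/-- A Volterra-type uniqueness lemma (elementary Gronwall by steps). -/
theorem volterra_zero (a : ℝ) (f d : ℝ → ℝ) (hf : Integrable f) (hf0 : ∀ y, 0 ≤ f y)
    (hdf : IntervalIntegrable (fun y => |d y| * f y) volume 0 a)
    (K M : ℝ) (hK : 0 < K) (hM : ∀ x ∈ Set.Icc (0 : ℝ) a, |d x| ≤ M)
    (h : ∀ x ∈ Set.Icc (0 : ℝ) a, |d x| ≤ K * ∫ y in x..a, |d y| * f y) :
    ∀ x ∈ Set.Icc (0 : ℝ) a, d x = 0 := by
  have hsub : ∀ x ∈ Set.Icc (0 : ℝ) a, ∀ y ∈ Set.Icc (0 : ℝ) a,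
      IntervalIntegrable (fun y => |d y| * f y) volume x y := by
    intro x hx y hy
    apply hdf.mono_set
    rw [Set.uIcc_of_le (hx.1.trans hx.2)]
    exact Set.uIcc_subset_Icc hx hy
  have hcont : Continuous (fun x => ∫ y in (0 : ℝ)..x, f y) :=
    intervalIntegral.continuous_primitive (fun _ _ => hf.intervalIntegrable) 0
  have hunif : UniformContinuousOn (fun x => ∫ y in (0 : ℝ)..x, f y) (Set.Icc 0 a) :=
    isCompact_Icc.uniformContinuousOn_of_continuous hcont.continuousOn
  rw [Metric.uniformContinuousOn_iff] at hunif
  obtain ⟨δ, hδ, hδ'⟩ := hunif (1 / (2 * K)) (by positivity)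
  have hsmall : ∀ x ∈ Set.Icc (0 : ℝ) a, ∀ z ∈ Set.Icc (0 : ℝ) a, x ≤ z → z - x < δ →
      ∫ y in x..z, f y ≤ 1 / (2 * K) := by
    intro x hx z hz hxz hlt
    have h1 := hδ' z hz x hx (by rw [Real.dist_eq, abs_of_nonneg (by linarith)]; exact hlt)
    rw [Real.dist_eq] at h1
    have h2 : (∫ y in (0 : ℝ)..z, f y) - ∫ y in (0 : ℝ)..x, f y = ∫ y in x..z, f y :=
      intervalIntegral.integral_interval_sub_left hf.intervalIntegrable hf.intervalIntegrable
    simp only [h2] at h1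
    exact (le_abs_self _).trans h1.le
  have key : ∀ N : ℕ, ∀ x ∈ Set.Icc (0 : ℝ) a, a - N * (δ / 2) ≤ x → d x = 0 := by
    intro N
    induction N with
    | zero =>
      intro x hx hxa
      have hxa' : x = a := le_antisymm hx.2 (by simpa using hxa)
      have := h x hx
      rw [hxa', intervalIntegral.integral_same, mul_zero] at this
      rw [hxa']
      exact abs_nonpos_iff.1 this
    | succ N ih =>
      have hj : ∀ j : ℕ, ∀ x ∈ Set.Icc (0 : ℝ) a, a - (N + 1 : ℕ) * (δ / 2) ≤ x →
          |d x| ≤ M * (1 / 2) ^ j := by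
        intro j
        induction j with
        | zero => intro x hx _; simpa using hM x hx
        | succ j ihj =>
          intro x hx hxN
          have hMj : 0 ≤ M * (1 / 2) ^ j := (abs_nonneg _).trans (ihj x hx hxN)
          by_cases hxz : a - N * (δ / 2) ≤ x
          · rw [ih x hx hxz, abs_zero, pow_succ, ← mul_assoc]
            positivity
          · push Not at hxz
            have hN : (0 : ℝ) ≤ N * (δ / 2) := by positivity
            obtain ⟨z, hzdef⟩ : ∃ z, z = a - N * (δ / 2) := ⟨_, rfl⟩
            rw [← hzdef] at hxz
            have hz : z ∈ Set.Icc (0 : ℝ) a := ⟨by linarith [hx.1], by linarith⟩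
            have haa : a ∈ Set.Icc (0 : ℝ) a := ⟨hx.1.trans hx.2, le_rfl⟩
            push_cast at hxN
            have hsplit := intervalIntegral.integral_add_adjacent_intervals
              (hsub x hx z hz) (hsub z hz a haa)
            have hzero : ∫ y in z..a, |d y| * f y = 0 := by
              apply intervalIntegral.integral_zero_ae
              refine Filter.Eventually.of_forall fun y hy => ?_
              rw [Set.uIoc_of_le hz.2] at hy
              rw [ih y ⟨hz.1.trans hy.1.le, hy.2⟩ (by linarith [hy.1])]
              simp
            have hle : ∫ y in x..z, |d y| * f y ≤ ∫ y in x..z, M * (1 / 2) ^ j * f y := by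
              apply intervalIntegral.integral_mono_on hxz.le (hsub x hx z hz)
                (hf.intervalIntegrable.const_mul _)
              intro y hy
              exact mul_le_mul_of_nonneg_right
                (ihj y ⟨hx.1.trans hy.1, hy.2.trans hz.2⟩ (by push_cast; linarith [hy.1])) (hf0 y)
            rw [intervalIntegral.integral_const_mul] at hle
            have h3 := hsmall x hx z hz hxz.le (by linarith)
            calc |d x| ≤ K * ∫ y in x..a, |d y| * f y := h x hx
              _ ≤ K * (M * (1 / 2) ^ j * (1 / (2 * K))) := by
                  rw [← hsplit, hzero, add_zero]
                  exact mul_le_mul_of_nonneg_left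
                    (hle.trans (mul_le_mul_of_nonneg_left h3 hMj)) hK.le
              _ = M * (1 / 2) ^ (j + 1) := by rw [pow_succ]; field_simp
      intro x hx hxN
      have hlim : Filter.Tendsto (fun j : ℕ => M * (1 / 2 : ℝ) ^ j) Filter.atTop (nhds (M * 0)) :=
        (tendsto_pow_atTop_nhds_zero_of_lt_one (by norm_num) (by norm_num)).const_mul M
      rw [mul_zero] at hlim
      exact abs_nonpos_iff.1 (ge_of_tendsto' hlim fun j => hj j x hx hxN)
  intro x hx
  obtain ⟨N, hN⟩ := exists_nat_ge (a / (δ / 2))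
  rw [div_le_iff₀ (by positivity)] at hN
  exact key N x hx (by linarith [hx.1])

/-- Uniqueness of bounded measurable nonnegative solutions of the functional
equation `q(x) = (1 − k/n) ∫_x^a q(y) f_{n,k}(y;x) dy + θ(x)` on `[0,a]`. -/
theorem stmt_6 (n k : ℕ) (hk : 1 ≤ k) (hkn : k ≤ n - 1)
    (a : ℝ) (ha : 0 < a)
    (f : ℝ → ℝ) (hfmeas : Measurable f) (hfnonneg : ∀ y, 0 ≤ f y)
    (hfsupp : ∀ y ≤ (0 : ℝ), f y = 0) (hfint : ∫ y, f y = 1)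
    (F : ℝ → ℝ) (hF : ∀ t, F t = ∫ y in Set.Iic t, f y)
    (hFa : F a < 1)
    (θ : ℝ → ℝ) (hθmeas : Measurable θ) (hθbd : ∃ C, ∀ x ∈ Set.Icc (0 : ℝ) a, |θ x| ≤ C)
    (q₁ q₂ : ℝ → ℝ) (hq₁meas : Measurable q₁) (hq₂meas : Measurable q₂)
    (hq₁bd : ∃ C, ∀ x ∈ Set.Icc (0 : ℝ) a, |q₁ x| ≤ C)
    (hq₂bd : ∃ C, ∀ x ∈ Set.Icc (0 : ℝ) a, |q₂ x| ≤ C)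
    (hq₁nonneg : ∀ x ∈ Set.Icc (0 : ℝ) a, 0 ≤ q₁ x)
    (hq₂nonneg : ∀ x ∈ Set.Icc (0 : ℝ) a, 0 ≤ q₂ x)
    (hq₁ : ∀ x ∈ Set.Icc (0 : ℝ) a,
      q₁ x = (1 - (k : ℝ) / n) * (∫ y in x..a, q₁ y * orderPDF f F n k x y) + θ x)
    (hq₂ : ∀ x ∈ Set.Icc (0 : ℝ) a,
      q₂ x = (1 - (k : ℝ) / n) * (∫ y in x..a, q₂ y * orderPDF f F n k x y) + θ x) :
    Set.EqOn q₁ q₂ (Set.Icc 0 a) := by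
  have hfi : Integrable f := by
    by_contra hcon
    rw [integral_undef hcon] at hfint
    exact zero_ne_one hfint
  have hFmono : Monotone F := by
    intro s t hst
    rw [hF, hF]
    exact setIntegral_mono_set hfi.integrableOn (Filter.Eventually.of_forall fun y => hfnonneg y)
      (Set.Iic_subset_Iic.2 hst).eventuallyLE
  have hFmeas : Measurable F := hFmono.measurable
  have h1a : 0 < 1 - F a := by linarith
  set B : ℝ := (k : ℝ) * (n.choose k) with hB
  have hB0 : 0 ≤ B := by positivity
  have hp : ∀ x y, x ≤ y → y ≤ a →
      0 ≤ orderPDF f F n k x y ∧ orderPDF f F n k x y ≤ B / (1 - F a) * f y := by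
    intro x y hxy hya
    have hx1 : 1 - F a ≤ 1 - F x := by linarith [hFmono (hxy.trans hya)]
    have hx0 : 0 < 1 - F x := by linarith
    have hc0 : 0 ≤ condCDF' F x y := div_nonneg (by linarith [hFmono hxy]) hx0.le
    have hc1 : condCDF' F x y ≤ 1 := by
      unfold condCDF'
      rw [div_le_one hx0]
      linarith [hFmono hya]
    have hu0 : 0 ≤ condCDF' F x y ^ (k - 1) := pow_nonneg hc0 _
    have hu1 : condCDF' F x y ^ (k - 1) ≤ 1 := pow_le_one₀ hc0 hc1
    have hv0 : 0 ≤ (1 - condCDF' F x y) ^ (n - k) := pow_nonneg (by linarith) _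
    have hv1 : (1 - condCDF' F x y) ^ (n - k) ≤ 1 := pow_le_one₀ (by linarith) (by linarith)
    have hw0 : 0 ≤ f y / (1 - F x) := div_nonneg (hfnonneg y) hx0.le
    have hw1 : f y / (1 - F x) ≤ f y / (1 - F a) :=
      div_le_div_of_nonneg_left (hfnonneg y) h1a hx1
    unfold orderPDF
    rw [← hB]
    refine ⟨by positivity, ?_⟩
    calc B * condCDF' F x y ^ (k - 1) * (f y / (1 - F x)) * (1 - condCDF' F x y) ^ (n - k)
        ≤ B * condCDF' F x y ^ (k - 1) * (f y / (1 - F x)) * 1 :=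
          mul_le_mul_of_nonneg_left hv1 (by positivity)
      _ ≤ B * 1 * (f y / (1 - F x)) * 1 := by gcongr
      _ ≤ B * 1 * (f y / (1 - F a)) * 1 := by gcongr
      _ = B / (1 - F a) * f y := by ring
  have hpmeas : ∀ x, Measurable (fun y => orderPDF f F n k x y) := by
    intro x
    unfold orderPDF condCDF'
    fun_prop
  have hint : ∀ q : ℝ → ℝ, Measurable q → (∃ C, ∀ x ∈ Set.Icc (0 : ℝ) a, |q x| ≤ C) →
      ∀ x ∈ Set.Icc (0 : ℝ) a,
        IntervalIntegrable (fun y => q y * orderPDF f F n k x y) volume x a := by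
    rintro q hq ⟨C, hC⟩ x hx
    refine IntervalIntegrable.mono_fun' (g := fun y => C * (B / (1 - F a)) * f y)
      (hfi.intervalIntegrable.const_mul _) (hq.mul (hpmeas x)).aestronglyMeasurable ?_
    rw [Filter.EventuallyLE, ae_restrict_iff' measurableSet_uIoc]
    refine Filter.Eventually.of_forall fun y hy => ?_
    rw [Set.uIoc_of_le hx.2] at hy
    obtain ⟨hp0, hp1⟩ := hp x y hy.1.le hy.2
    have hCy := hC y ⟨hx.1.trans hy.1.le, hy.2⟩
    simp only [Real.norm_eq_abs, abs_mul, abs_of_nonneg hp0]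
    rw [mul_assoc]
    exact mul_le_mul hCy hp1 hp0 ((abs_nonneg _).trans hCy)
  obtain ⟨C₁, hC₁⟩ := hq₁bd
  obtain ⟨C₂, hC₂⟩ := hq₂bd
  have hdM : ∀ x ∈ Set.Icc (0 : ℝ) a, |q₁ x - q₂ x| ≤ C₁ + C₂ := fun x hx =>
    (abs_sub _ _).trans (add_le_add (hC₁ x hx) (hC₂ x hx))
  have hdf : IntervalIntegrable (fun y => |q₁ y - q₂ y| * f y) volume 0 a := by
    refine IntervalIntegrable.mono_fun' (g := fun y => (C₁ + C₂) * f y)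
      (hfi.intervalIntegrable.const_mul _) (by fun_prop) ?_
    rw [Filter.EventuallyLE, ae_restrict_iff' measurableSet_uIoc]
    refine Filter.Eventually.of_forall fun y hy => ?_
    rw [Set.uIoc_of_le ha.le] at hy
    simp only [Real.norm_eq_abs, abs_mul, abs_abs, abs_of_nonneg (hfnonneg y)]
    exact mul_le_mul_of_nonneg_right (hdM y ⟨hy.1.le, hy.2⟩) (hfnonneg y)
  have hn : (0 : ℝ) < n := by
    have : 0 < n := by omega
    exact_mod_cast this
  have hc1 : (1 - (k : ℝ) / n) ≤ 1 := by
    have : (0 : ℝ) ≤ (k : ℝ) / n := by positivity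
    linarith
  have hc0 : 0 ≤ (1 - (k : ℝ) / n) := by
    rw [sub_nonneg, div_le_one hn]
    exact_mod_cast (by omega : k ≤ n)
  have hK0 : 0 ≤ B / (1 - F a) := div_nonneg hB0 h1a.le
  intro x hx
  refine sub_eq_zero.1 (volterra_zero a f (fun y => q₁ y - q₂ y) hfi hfnonneg hdf
    (B / (1 - F a) + 1) (C₁ + C₂) (by linarith) hdM ?_ x hx)
  clear x hx
  intro x hx
  have i1 := hint q₁ hq₁meas ⟨C₁, hC₁⟩ x hx
  have i2 := hint q₂ hq₂meas ⟨C₂, hC₂⟩ x hx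
  have hsubint : IntervalIntegrable (fun y => |q₁ y - q₂ y| * f y) volume x a := by
    apply hdf.mono_set
    rw [Set.uIcc_of_le ha.le, Set.uIcc_of_le hx.2]
    exact Set.Icc_subset_Icc_left hx.1
  have e : q₁ x - q₂ x = (1 - (k : ℝ) / n) *
      ∫ y in x..a, (q₁ y * orderPDF f F n k x y - q₂ y * orderPDF f F n k x y) := by
    rw [intervalIntegral.integral_sub i1 i2, hq₁ x hx, hq₂ x hx]
    ring
  have hI0 : 0 ≤ ∫ y in x..a, |q₁ y - q₂ y| * f y :=
    intervalIntegral.integral_nonneg hx.2 fun y _ => mul_nonneg (abs_nonneg _) (hfnonneg y)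
  have hI : |∫ y in x..a, (q₁ y * orderPDF f F n k x y - q₂ y * orderPDF f F n k x y)|
      ≤ B / (1 - F a) * ∫ y in x..a, |q₁ y - q₂ y| * f y := by
    refine (intervalIntegral.abs_integral_le_integral_abs hx.2).trans ?_
    rw [← intervalIntegral.integral_const_mul]
    apply intervalIntegral.integral_mono_on hx.2 (i1.sub i2).abs (hsubint.const_mul _)
    intro y hy
    obtain ⟨hp0, hp1⟩ := hp x y hy.1 hy.2
    rw [← sub_mul, abs_mul, abs_of_nonneg hp0]
    calc _ ≤ |q₁ y - q₂ y| * (B / (1 - F a) * f y) :=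
          mul_le_mul_of_nonneg_left hp1 (abs_nonneg _)
      _ = _ := by ring
  show |q₁ x - q₂ x| ≤ _
  rw [e, abs_mul, abs_of_nonneg hc0]
  calc _ ≤ 1 * |∫ y in x..a, (q₁ y * orderPDF f F n k x y - q₂ y * orderPDF f F n k x y)| :=
        mul_le_mul_of_nonneg_right hc1 (abs_nonneg _)
    _ ≤ B / (1 - F a) * ∫ y in x..a, |q₁ y - q₂ y| * f y := by rw [one_mul]; exact hI
    _ ≤ _ := by
      show _ ≤ (B / (1 - F a) + 1) * ∫ y in x..a, |q₁ y - q₂ y| * f y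
      linarith
end

section
/- Let n, k be integers with 1 ≤ k ≤ n−1, let a > 0, and let X be a positive real random variable with density f and cumulative distribution function F with F(a) < 1. Then for every x ∈ [0,a], (1 − k/n) ∫_x^a (1 − F(a;y)) f_{n,k}(y;x) dy = (1 − F(a;x)) · F_{n−1,k}(a;x). -/
open MeasureTheory

/-- For every `x ∈ [0,a]`,
`(1 − k/n) ∫_x^a (1 − F(a;y)) f_{n,k}(y;x) dy = (1 − F(a;x))·F_{n−1,k}(a;x)`,
where `F_{n−1,k}(a;x) = ∫_x^a f_{n−1,k}(y;x) dy`. -/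
theorem stmt_7 (n k : ℕ) (hk : 1 ≤ k) (hkn : k ≤ n - 1)
    (a : ℝ) (ha : 0 < a)
    (f : ℝ → ℝ) (hfmeas : Measurable f) (hfnonneg : ∀ y, 0 ≤ f y)
    (hfsupp : ∀ y ≤ (0 : ℝ), f y = 0) (hfint : ∫ y, f y = 1)
    (F : ℝ → ℝ) (hF : ∀ t, F t = ∫ y in Set.Iic t, f y)
    (hFa : F a < 1)
    (x : ℝ) (hx : x ∈ Set.Icc (0 : ℝ) a) :
    (1 - (k : ℝ) / n) * (∫ y in x..a, (1 - condCDF' F y a) * orderPDF f F n k x y)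
      = (1 - condCDF' F x a) * (∫ y in x..a, orderPDF f F (n - 1) k x y) := by
  have hi : Integrable f := by
    by_contra h
    rw [integral_undef h] at hfint
    norm_num at hfint
  have hmono : ∀ s t, s ≤ t → F s ≤ F t := by
    intro s t hst
    rw [hF, hF]
    exact setIntegral_mono_set hi.integrableOn
      (Filter.Eventually.of_forall (fun y => hfnonneg y))
      (Set.Iic_subset_Iic.mpr hst).eventuallyLE
  obtain ⟨m, rfl⟩ : ∃ m, n = m + 1 := ⟨n - 1, by omega⟩
  have hkm : k ≤ m := by omega
  simp only [Nat.add_sub_cancel]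
  rw [← intervalIntegral.integral_const_mul, ← intervalIntegral.integral_const_mul]
  apply intervalIntegral.integral_congr
  intro y hy
  rw [Set.uIcc_of_le hx.2] at hy
  have h1 : (1 - F x) ≠ 0 := by
    have := hmono x a hx.2
    intro h; linarith
  have h2 : (1 - F y) ≠ 0 := by
    have := hmono y a hy.2
    intro h; linarith
  have hc : (m.choose k : ℝ) * (m + 1) = ((m + 1).choose k : ℝ) * (m + 1 - k) := by
    have := Nat.choose_mul_succ_eq m k
    have h3 : ((m + 1 - k : ℕ) : ℝ) = m + 1 - k := by
      rw [Nat.cast_sub (by omega)]; push_cast; ring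
    rw [← h3]
    exact_mod_cast this
  have hm : (m : ℝ) + 1 ≠ 0 := by positivity
  have hc' : (1 - (k : ℝ) / ((m + 1 : ℕ) : ℝ)) * ((m + 1).choose k : ℝ) = m.choose k := by
    push_cast
    field_simp
    linarith
  have e1 : 1 - condCDF' F y a = (1 - F a) / (1 - F y) := by
    unfold condCDF'; field_simp; ring
  have e2 : 1 - condCDF' F x y = (1 - F y) / (1 - F x) := by
    unfold condCDF'; field_simp; ring
  have e3 : 1 - condCDF' F x a = (1 - F a) / (1 - F x) := by
    unfold condCDF'; field_simp; ring
  have e4 : (1 - F a) / (1 - F y) * ((1 - F y) / (1 - F x)) = (1 - F a) / (1 - F x) := by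
    field_simp
  have e5 : m + 1 - k = (m - k) + 1 := by omega
  simp only [orderPDF]
  rw [e1, e2, e3, e5, pow_succ, ← hc', ← e4]
  ring
end

section
/- Let n, k be integers with 1 ≤ k ≤ n−1, let a > 0, and let X be a positive real random variable with density f and cumulative distribution function F with F(a) < 1. Then the function P(x) := (1 − F(a))/(1 − F(x)) is the unique bounded measurable nonnegative solution on [0,a] of the functional equation q(x) = (1 − k/n) ∫_x^a q(y) f_{n,k}(y;x) dy + (1 − F(a;x)) · (1 − F_{n−1,k}(a;x)), x ∈ [0,a]. (Since the expectation of the Adaptive Multilevel Splitting estimator satisfies this functional equation, this expresses that the estimator p̂^{n,k}(x) is an unbiased estimator of the conditional probability P(x) = P(X > a | X > x).) -/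
open MeasureTheory

lemma aux_core (a : ℝ) (f F : ℝ → ℝ) (hf0 : ∀ y, 0 ≤ f y) (hfi : Integrable f)
    (hFc : Continuous F) (hFd : ∀ s t, s ≤ t → F t - F s = ∫ y in s..t, f y)
    (d : ℝ → ℝ) (o : ℝ → ℝ → ℝ) (c K C : ℝ) (hc : |c| ≤ 1) (hK : 0 ≤ K)
    (ha : 0 ≤ a)
    (ho : ∀ x y, 0 ≤ x → x ≤ y → y ≤ a → |o x y| ≤ K * f y)
    (hdC : ∀ x ∈ Set.Icc 0 a, |d x| ≤ C)
    (hi : ∀ x ∈ Set.Icc 0 a, IntervalIntegrable (fun y => d y * o x y) volume x a)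
    (hd : ∀ x ∈ Set.Icc 0 a, d x = c * ∫ y in x..a, d y * o x y) :
    ∀ x ∈ Set.Icc 0 a, d x = 0 := by
  set T : Set ℝ := {t | t ∈ Set.Icc 0 a ∧ ∀ y ∈ Set.Icc t a, d y = 0} with hT
  have haT : a ∈ T := by
    refine ⟨⟨ha, le_rfl⟩, fun y hy => ?_⟩
    have : y = a := le_antisymm hy.2 hy.1
    subst this
    rw [hd y ⟨ha, le_rfl⟩]; simp
  have hbdd : BddBelow T := ⟨0, fun t ht => ht.1.1⟩
  set s := sInf T with hs
  have hs0 : 0 ≤ s := le_csInf ⟨a, haT⟩ fun t ht => ht.1.1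
  have hsa : s ≤ a := csInf_le hbdd haT
  have hgt : ∀ y, s < y → y ≤ a → d y = 0 := by
    intro y hy hya
    obtain ⟨t, ht, hty⟩ := exists_lt_of_csInf_lt ⟨a, haT⟩ hy
    exact ht.2 y ⟨hty.le, hya⟩
  have hz : ∀ x, ∫ y in s..a, d y * o x y = 0 := by
    intro x
    apply intervalIntegral.integral_zero_ae
    refine Filter.Eventually.of_forall fun y hy => ?_
    rw [Set.uIoc_of_le hsa] at hy
    simp [hgt y hy.1 hy.2]
  have hge : ∀ y, s ≤ y → y ≤ a → d y = 0 := by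
    intro y hy hya
    rcases hy.eq_or_lt with h | h
    · rw [← h, hd s ⟨hs0, hsa⟩, hz]; simp
    · exact hgt y h hya
  rcases hs0.eq_or_lt with h0 | h0
  · intro x hx
    exact hge x (h0 ▸ hx.1) hx.2
  exfalso
  have hcont : Filter.Tendsto (fun t => K * (F s - F t)) (nhdsWithin s (Set.Iio s)) (nhds 0) := by
    have : Continuous (fun t => K * (F s - F t)) := by fun_prop
    have h := (this.tendsto s).mono_left (nhdsWithin_le_nhds (s := Set.Iio s))
    simpa using h
  have hev := hcont.eventually (gt_mem_nhds (show (0:ℝ) < 1/2 by norm_num))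
  have hev2 : ∀ᶠ t in nhdsWithin s (Set.Iio s), t ∈ Set.Ioo 0 s := Ioo_mem_nhdsLT h0
  obtain ⟨t, ht1, ht2⟩ := (hev.and hev2).exists
  have hstep : ∀ M : ℝ, 0 ≤ M → (∀ x, t ≤ x → x ≤ s → |d x| ≤ M) →
      ∀ x, t ≤ x → x ≤ s → |d x| ≤ M / 2 := by
    intro M hM hb x hx hxs
    have hxm : x ∈ Set.Icc 0 a := ⟨ht2.1.le.trans hx, hxs.trans hsa⟩
    have hix := hi x hxm
    have hsplit : ∫ y in x..a, d y * o x y = ∫ y in x..s, d y * o x y := by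
      rw [← intervalIntegral.integral_add_adjacent_intervals (b := s), hz, add_zero]
      · exact hix.mono_set (by
          rw [Set.uIcc_of_le hxs, Set.uIcc_of_le hxm.2]; exact Set.Icc_subset_Icc le_rfl hsa)
      · exact hix.mono_set (by
          rw [Set.uIcc_of_le hsa, Set.uIcc_of_le hxm.2]; exact Set.Icc_subset_Icc hxs le_rfl)
    have hbd : |∫ y in x..s, d y * o x y| ≤ ∫ y in x..s, (M * K) * f y := by
      rw [← Real.norm_eq_abs]
      apply intervalIntegral.norm_integral_le_of_norm_le hxs
      · refine Filter.Eventually.of_forall fun y hy => ?_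
        rw [Real.norm_eq_abs, abs_mul, mul_assoc]
        exact mul_le_mul (hb y (hx.trans hy.1.le) hy.2)
          (ho x y hxm.1 hy.1.le (hy.2.trans hsa)) (abs_nonneg _) hM
      · exact (hfi.const_mul _).intervalIntegrable
    rw [intervalIntegral.integral_const_mul, ← hFd x s hxs] at hbd
    have hFx : F t ≤ F x := by
      have h1 := hFd t x hx
      have h2 : 0 ≤ ∫ y in t..x, f y := intervalIntegral.integral_nonneg hx fun y _ => hf0 y
      linarith
    rw [hd x hxm, hsplit, abs_mul]
    have h3 : |c| * |∫ y in x..s, d y * o x y| ≤ 1 * |∫ y in x..s, d y * o x y| :=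
      mul_le_mul_of_nonneg_right hc (abs_nonneg _)
    have h4 : K * (F s - F x) ≤ 1 / 2 := by
      have := mul_le_mul_of_nonneg_left hFx hK
      linarith
    have h5 := mul_le_mul_of_nonneg_left h4 hM
    linarith
  have hC : 0 ≤ C := (abs_nonneg _).trans (hdC 0 ⟨le_rfl, ha⟩)
  have hall : ∀ m : ℕ, ∀ x, t ≤ x → x ≤ s → |d x| ≤ C * (1 / 2) ^ m := by
    intro m
    induction m with
    | zero =>
      intro x hx hxs
      simpa using hdC x ⟨ht2.1.le.trans hx, hxs.trans hsa⟩
    | succ m ih =>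
      intro x hx hxs
      have := hstep _ (by positivity) ih x hx hxs
      rw [pow_succ]
      linarith
  have hzero : ∀ x, t ≤ x → x ≤ s → d x = 0 := by
    intro x hx hxs
    have hl : Filter.Tendsto (fun m : ℕ => C * (1 / 2 : ℝ) ^ m) Filter.atTop (nhds (C * 0)) :=
      (tendsto_pow_atTop_nhds_zero_of_lt_one (by norm_num) (by norm_num)).const_mul C
    have := ge_of_tendsto' hl (fun m => hall m x hx hxs)
    rw [mul_zero] at this
    exact abs_eq_zero.mp (le_antisymm this (abs_nonneg _))
  have htT : t ∈ T := ⟨⟨ht2.1.le, ht2.2.le.trans hsa⟩, fun y hy => by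
    rcases le_total y s with h | h
    · exact hzero y hy.1 h
    · exact hge y h hy.2⟩
  exact absurd (csInf_le hbdd htT) (not_le.mpr ht2.2)

/-- `P(x) = (1 − F(a))/(1 − F(x))` is the unique bounded measurable
nonnegative solution on `[0,a]` of the functional equation
`q(x) = (1 − k/n) ∫_x^a q(y) f_{n,k}(y;x) dy + (1 − F(a;x))·(1 − F_{n−1,k}(a;x))`:
the AMS estimator is an unbiased estimator of `P(x) = P(X > a | X > x)`. -/
theorem stmt_8 (n k : ℕ) (hk : 1 ≤ k) (hkn : k ≤ n - 1)
    (a : ℝ) (ha : 0 < a)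
    (f : ℝ → ℝ) (hfmeas : Measurable f) (hfnonneg : ∀ y, 0 ≤ f y)
    (hfsupp : ∀ y ≤ (0 : ℝ), f y = 0) (hfint : ∫ y, f y = 1)
    (F : ℝ → ℝ) (hF : ∀ t, F t = ∫ y in Set.Iic t, f y)
    (hFa : F a < 1)
    (P : ℝ → ℝ) (hP : ∀ x, P x = (1 - F a) / (1 - F x)) :
    -- `P` solves the functional equation
    (∀ x ∈ Set.Icc (0 : ℝ) a,
      P x = (1 - (k : ℝ) / n) * (∫ y in x..a, P y * orderPDF f F n k x y)
        + (1 - condCDF' F x a) * (1 - ∫ y in x..a, orderPDF f F (n - 1) k x y))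
    -- and it is the unique bounded measurable nonnegative solution
    ∧ (∀ q : ℝ → ℝ, Measurable q → (∃ C, ∀ x ∈ Set.Icc (0 : ℝ) a, |q x| ≤ C) →
        (∀ x ∈ Set.Icc (0 : ℝ) a, 0 ≤ q x) →
        (∀ x ∈ Set.Icc (0 : ℝ) a,
          q x = (1 - (k : ℝ) / n) * (∫ y in x..a, q y * orderPDF f F n k x y)
            + (1 - condCDF' F x a) * (1 - ∫ y in x..a, orderPDF f F (n - 1) k x y)) →
        Set.EqOn q P (Set.Icc 0 a)) := by
  have hfi : Integrable f := by
    by_contra h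
    rw [integral_undef h] at hfint
    exact zero_ne_one hfint
  have hFd : ∀ s t, s ≤ t → F t - F s = ∫ y in s..t, f y := by
    intro s t _
    rw [hF, hF, intervalIntegral.integral_Iic_sub_Iic hfi.integrableOn hfi.integrableOn]
  have hmono : Monotone F := by
    intro s t hst
    have h1 := hFd s t hst
    have h2 : 0 ≤ ∫ y in s..t, f y := intervalIntegral.integral_nonneg hst fun y _ => hfnonneg y
    linarith
  have hFc : Continuous F := by
    have h1 : F = fun t => F 0 + ∫ y in (0:ℝ)..t, f y := by
      funext t
      rw [hF, hF, ← intervalIntegral.integral_Iic_sub_Iic hfi.integrableOn hfi.integrableOn]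
      ring
    rw [h1]
    exact continuous_const.add
      (intervalIntegral.continuous_primitive (fun _ _ => hfi.intervalIntegrable) 0)
  have hpos : ∀ y, y ≤ a → 0 < 1 - F y := fun y hy => by
    have := hmono hy
    linarith
  have hn : 0 < n := by omega
  have hnR : (0 : ℝ) < n := by exact_mod_cast hn
  have hknR : (k : ℝ) ≤ n := by exact_mod_cast (by omega : k ≤ n)
  have hchoose : (1 - (k : ℝ) / n) * (n.choose k : ℝ) = ((n - 1).choose k : ℝ) := by
    obtain ⟨m, rfl⟩ : ∃ m, n = m + 1 := ⟨n - 1, by omega⟩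
    have h := Nat.choose_mul_succ_eq m k
    have h' : (m.choose k : ℝ) * ((m : ℝ) + 1) = ((m + 1).choose k : ℝ) * ((m : ℝ) + 1 - k) := by
      have hk' : k ≤ m + 1 := by omega
      have := congrArg (Nat.cast : ℕ → ℝ) h
      push_cast [Nat.cast_sub hk'] at this
      exact this
    simp only [Nat.add_sub_cancel]
    push_cast at hnR ⊢
    field_simp
    linarith
  have hker : ∀ x y, y ≤ a → x ≤ y →
      (1 - (k : ℝ) / n) * (P y * orderPDF f F n k x y) = P x * orderPDF f F (n - 1) k x y := by
    intro x y hy hxy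
    have hx0 := (hpos x (hxy.trans hy)).ne'
    have hy0 := (hpos y hy).ne'
    have e1 : 1 - condCDF' F x y = (1 - F y) / (1 - F x) := by
      unfold condCDF'
      field_simp
      ring
    unfold orderPDF
    rw [← hchoose, e1, hP, hP, show n - k = (n - 1 - k) + 1 by omega, pow_succ]
    field_simp
  have hPsol : ∀ x ∈ Set.Icc (0 : ℝ) a,
      P x = (1 - (k : ℝ) / n) * (∫ y in x..a, P y * orderPDF f F n k x y)
        + (1 - condCDF' F x a) * (1 - ∫ y in x..a, orderPDF f F (n - 1) k x y) := by
    intro x hx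
    have hx0 := (hpos x hx.2).ne'
    have e2 : 1 - condCDF' F x a = P x := by
      rw [hP]
      unfold condCDF'
      field_simp
      ring
    have e3 : (1 - (k : ℝ) / n) * (∫ y in x..a, P y * orderPDF f F n k x y)
        = P x * ∫ y in x..a, orderPDF f F (n - 1) k x y := by
      rw [← intervalIntegral.integral_const_mul, ← intervalIntegral.integral_const_mul]
      apply intervalIntegral.integral_congr
      intro y hy
      rw [Set.uIcc_of_le hx.2] at hy
      exact hker x y hy.2 hy.1
    rw [e2, e3]
    ring
  refine ⟨hPsol, ?_⟩
  rintro q hq ⟨C, hC⟩ hq0 hqsol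
  have hPm : Measurable P := by
    have : P = fun x => (1 - F a) / (1 - F x) := funext hP
    rw [this]
    have := hFc.measurable
    fun_prop
  have hPb : ∀ x ∈ Set.Icc (0 : ℝ) a, |P x| ≤ 1 := by
    intro x hx
    have h1 := hpos x hx.2
    have h2 := hpos a le_rfl
    have h3 := hmono hx.2
    rw [hP, abs_of_nonneg (by positivity), div_le_one h1]
    linarith
  set K : ℝ := (k : ℝ) * (n.choose k) / (1 - F a) with hKdef
  have hK : 0 ≤ K := div_nonneg (by positivity) (hpos a le_rfl).le
  have ho : ∀ x y, 0 ≤ x → x ≤ y → y ≤ a → |orderPDF f F n k x y| ≤ K * f y := by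
    intro x y _ hxy hya
    have h1 := hpos x (hxy.trans hya)
    have h2 := hpos y hya
    have h3 := hpos a le_rfl
    have m1 := hmono hxy
    have m2 := hmono (hxy.trans hya)
    have c0 : 0 ≤ condCDF' F x y := div_nonneg (by linarith) h1.le
    have c1 : condCDF' F x y ≤ 1 := by
      unfold condCDF'
      rw [div_le_one h1]
      linarith
    have p1 : condCDF' F x y ^ (k - 1) ≤ 1 := pow_le_one₀ c0 c1
    have p2 : (1 - condCDF' F x y) ^ (n - k) ≤ 1 := pow_le_one₀ (by linarith) (by linarith)
    have p10 : 0 ≤ condCDF' F x y ^ (k - 1) := by positivity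
    have p20 : 0 ≤ (1 - condCDF' F x y) ^ (n - k) := pow_nonneg (by linarith) _
    have hfy := hfnonneg y
    have d1 : f y / (1 - F x) ≤ f y / (1 - F a) :=
      div_le_div_of_nonneg_left hfy h3 (by linarith)
    have d0 : 0 ≤ f y / (1 - F x) := by positivity
    have hkc : (0 : ℝ) ≤ (k : ℝ) * (n.choose k) := by positivity
    unfold orderPDF
    rw [abs_of_nonneg (by positivity)]
    calc (k : ℝ) * (n.choose k) * condCDF' F x y ^ (k - 1) * (f y / (1 - F x))
          * (1 - condCDF' F x y) ^ (n - k)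
        ≤ (k : ℝ) * (n.choose k) * 1 * (f y / (1 - F a)) * 1 := by gcongr
      _ = K * f y := by rw [hKdef]; ring
  have hom : ∀ x, Measurable (fun y => orderPDF f F n k x y) := by
    intro x
    have := hFc.measurable
    unfold orderPDF condCDF'
    fun_prop
  have hint : ∀ (g : ℝ → ℝ) (B : ℝ), Measurable g → (∀ x ∈ Set.Icc (0 : ℝ) a, |g x| ≤ B) →
      ∀ x ∈ Set.Icc (0 : ℝ) a,
        IntervalIntegrable (fun y => g y * orderPDF f F n k x y) volume x a := by
    intro g B hg hgB x hx
    rw [intervalIntegrable_iff_integrableOn_Ioc_of_le hx.2]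
    have hBi : IntegrableOn (fun y => B * (K * f y)) (Set.Ioc x a) :=
      ((hfi.const_mul K).const_mul B).integrableOn
    refine Integrable.mono' hBi (hg.mul (hom x)).aestronglyMeasurable ?_
    refine (ae_restrict_mem measurableSet_Ioc).mono fun y hy => ?_
    have hym : y ∈ Set.Icc (0 : ℝ) a := ⟨hx.1.trans hy.1.le, hy.2⟩
    rw [Real.norm_eq_abs, abs_mul]
    exact mul_le_mul (hgB y hym) (ho x y hx.1 hy.1.le hy.2) (abs_nonneg _)
      ((abs_nonneg _).trans (hgB y hym))
  have hdB : ∀ x ∈ Set.Icc (0 : ℝ) a, |q x - P x| ≤ C + 1 := fun x hx =>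
    (abs_sub _ _).trans (add_le_add (hC x hx) (hPb x hx))
  have hmain := aux_core a f F hfnonneg hfi hFc hFd (fun x => q x - P x) (orderPDF f F n k)
    (1 - (k : ℝ) / n) K (C + 1) (by
      have h1 : (k : ℝ) / n ≤ 1 := (div_le_one hnR).mpr hknR
      have h2 : (0 : ℝ) ≤ (k : ℝ) / n := by positivity
      rw [abs_le]
      constructor <;> linarith) hK ha.le ho hdB
    (hint (fun x => q x - P x) (C + 1) (hq.sub hPm) hdB) (by
      intro x hx
      have e : ∫ y in x..a, (q y - P y) * orderPDF f F n k x y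
          = (∫ y in x..a, q y * orderPDF f F n k x y)
            - ∫ y in x..a, P y * orderPDF f F n k x y := by
        rw [← intervalIntegral.integral_sub (hint q C hq hC x hx) (hint P 1 hPm hPb x hx)]
        simp only [sub_mul]
      have h1 := hqsol x hx
      have h2 := hPsol x hx
      simp only [e]
      linarith)
  intro x hx
  exact sub_eq_zero.mp (hmain x hx)
end

section
/- Let n be an integer, let X be a positive real random variable with density f and cumulative distribution function F, and let x be a point with F(x) < 1 at which F is differentiable with F'(x) = f(x). Then for every y > x: (i) the map x ↦ f_{n,1}(y;x) is differentiable at x with (d/dx) f_{n,1}(y;x) = (f(x)/(1 − F(x))) · n · f_{n,1}(y;x); and (ii) for every integer k with 2 ≤ k ≤ n−1, (d/dx) f_{n,k}(y;x) = (f(x)/(1 − F(x))) · (n − k + 1) · ( f_{n,k}(y;x) − f_{n,k−1}(y;x) ). In particular, in the exponential case f(y) = e^{−y} (y ≥ 0), for 0 ≤ x < y one has (d/dx) f_{n,1}(y;x) = n f_{n,1}(y;x) and (d/dx) f_{n,k}(y;x) = (n−k+1)( f_{n,k}(y;x) − f_{n,k−1}(y;x) ). -/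
open MeasureTheory

/-- The density of the exponential distribution with parameter 1: `f(y) = e^{−y}` for `y ≥ 0`. -/
noncomputable def expf : ℝ → ℝ := fun y => if 0 ≤ y then Real.exp (-y) else 0

/-- The CDF of the exponential distribution with parameter 1. -/
noncomputable def expF : ℝ → ℝ := fun t => if 0 ≤ t then 1 - Real.exp (-t) else 0


lemma hasDeriv_cond (f F : ℝ → ℝ) (s : Set ℝ) (x y : ℝ) (hF : 1 - F x ≠ 0)
    (h : HasDerivWithinAt F (f x) s x) :
    HasDerivWithinAt (fun u => condCDF' F u y)
      (-(f x / (1 - F x)) * (1 - condCDF' F x y)) s x := by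
  have h2 := ((h.const_sub (F y)).div (h.const_sub 1) hF)
  refine h2.congr_deriv ?_
  unfold condCDF'
  field_simp
  ring

lemma hasDeriv_fac (f F : ℝ → ℝ) (s : Set ℝ) (x y : ℝ) (hF : 1 - F x ≠ 0)
    (h : HasDerivWithinAt F (f x) s x) :
    HasDerivWithinAt (fun u => f y / (1 - F u))
      (f x / (1 - F x) * (f y / (1 - F x))) s x := by
  have h2 := ((hasDerivWithinAt_const x s (f y)).div (h.const_sub 1) hF)
  refine h2.congr_deriv ?_
  field_simp
  ring

lemma hasDeriv_pow_compl (f F : ℝ → ℝ) (s : Set ℝ) (x y : ℝ) (hF : 1 - F x ≠ 0)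
    (h : HasDerivWithinAt F (f x) s x) (l : ℕ) :
    HasDerivWithinAt (fun u => (1 - condCDF' F u y) ^ l)
      (l * (f x / (1 - F x)) * (1 - condCDF' F x y) ^ l) s x := by
  have h2 := ((hasDeriv_cond f F s x y hF h).const_sub 1).pow l
  refine h2.congr_deriv ?_
  rcases l with _ | l
  · simp
  · simp only [Nat.add_sub_cancel, pow_succ]
    ring

lemma part_one (f F : ℝ → ℝ) (s : Set ℝ) (x y : ℝ) (hF : 1 - F x ≠ 0)
    (h : HasDerivWithinAt F (f x) s x) (n : ℕ) :
    HasDerivWithinAt (fun u => orderPDF f F n 1 u y)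
      (f x / (1 - F x) * n * orderPDF f F n 1 x y) s x := by
  rcases n with _ | l
  · simpa [orderPDF] using hasDerivWithinAt_const x s (0 : ℝ)
  · have h2 := (((hasDeriv_fac f F s x y hF h).mul
      (hasDeriv_pow_compl f F s x y hF h l)).const_mul ((l : ℝ) + 1))
    have e : ∀ u, orderPDF f F (l + 1) 1 u y
        = ((l : ℝ) + 1) * (f y / (1 - F u) * (1 - condCDF' F u y) ^ l) := by
      intro u
      simp [orderPDF]
      ring
    simp only [e]
    refine h2.congr_deriv ?_
    push_cast
    ring

lemma part_two (f F : ℝ → ℝ) (s : Set ℝ) (x y : ℝ) (hF : 1 - F x ≠ 0)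
    (h : HasDerivWithinAt F (f x) s x) (n k : ℕ) (hk : 2 ≤ k) (hkn : k ≤ n - 1) :
    HasDerivWithinAt (fun u => orderPDF f F n k u y)
      (f x / (1 - F x) * ((n : ℝ) - k + 1)
        * (orderPDF f F n k x y - orderPDF f F n (k - 1) x y)) s x := by
  obtain ⟨m, rfl⟩ : ∃ m, k = m + 2 := ⟨k - 2, by omega⟩
  obtain ⟨l, rfl⟩ : ∃ l, n = m + 2 + l := ⟨n - (m + 2), by omega⟩
  have hch : ((m + 2 + l).choose (m + 2) : ℝ) * (m + 2)
      = (m + 2 + l).choose (m + 1) * (l + 1) := by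
    have := Nat.choose_succ_right_eq (m + 2 + l) (m + 1)
    rw [show m + 2 + l - (m + 1) = l + 1 by omega] at this
    exact_mod_cast this
  have h2 := (((((hasDeriv_cond f F s x y hF h).pow (m + 1)).mul
    (hasDeriv_fac f F s x y hF h)).mul
      (hasDeriv_pow_compl f F s x y hF h l)).const_mul
        (((m : ℝ) + 2) * ((m + 2 + l).choose (m + 2) : ℝ)))
  have e : ∀ u, orderPDF f F (m + 2 + l) (m + 2) u y
      = (((m : ℝ) + 2) * ((m + 2 + l).choose (m + 2) : ℝ)) *
        (condCDF' F u y ^ (m + 1) * (f y / (1 - F u)) * (1 - condCDF' F u y) ^ l) := by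
    intro u
    simp only [orderPDF, show m + 2 - 1 = m + 1 by omega, show m + 2 + l - (m + 2) = l by omega]
    push_cast
    ring
  have e' : orderPDF f F (m + 2 + l) (m + 2 - 1) x y
      = (((m : ℝ) + 1) * ((m + 2 + l).choose (m + 1) : ℝ)) *
        (condCDF' F x y ^ m * (f y / (1 - F x)) * (1 - condCDF' F x y) ^ (l + 1)) := by
    simp only [orderPDF, show m + 2 - 1 = m + 1 by omega,
      show m + 2 + l - (m + 1) = l + 1 by omega, Nat.add_sub_cancel]
    push_cast
    ring
  simp only [e, e']
  refine h2.congr_deriv ?_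
  simp only [Pi.mul_apply, Pi.pow_apply, Nat.add_sub_cancel]
  push_cast
  generalize condCDF' F x y = G
  generalize f y / (1 - F x) = b
  generalize f x / (1 - F x) = r
  linear_combination (-((m : ℝ) + 1) * r * b * G ^ m * (1 - G) ^ (l + 1)) * hch

lemma expF_deriv (x : ℝ) (hx : 0 ≤ x) : HasDerivWithinAt expF (expf x) (Set.Ici 0) x := by
  have h : HasDerivAt (fun t : ℝ => 1 - Real.exp (-t)) (Real.exp (-x)) x := by
    have := ((hasDerivAt_neg x).exp).const_sub 1
    simpa using this
  have h2 := h.hasDerivWithinAt (s := Set.Ici 0)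
  have h3 : HasDerivWithinAt expF (Real.exp (-x)) (Set.Ici 0) x :=
    h2.congr (fun t ht => by simp [expF, Set.mem_Ici.1 ht]) (by simp [expF, hx])
  simpa [expf, hx] using h3

/-- Derivative in `x` of the order-statistics densities `f_{n,k}(y;x)`:
`(d/dx) f_{n,1}(y;x) = (f(x)/(1−F(x)))·n·f_{n,1}(y;x)` and, for `2 ≤ k ≤ n−1`,
`(d/dx) f_{n,k}(y;x) = (f(x)/(1−F(x)))·(n−k+1)·(f_{n,k}(y;x) − f_{n,k−1}(y;x))`;
in particular in the exponential case the prefactor `f(x)/(1−F(x))` equals `1`. -/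
theorem stmt_9 (n : ℕ) (f F : ℝ → ℝ)
    (x : ℝ) (hFx : F x < 1) (hFdiff : HasDerivAt F (f x) x)
    (y : ℝ) (hxy : x < y) :
    -- (i)
    HasDerivAt (fun u => orderPDF f F n 1 u y)
        (f x / (1 - F x) * n * orderPDF f F n 1 x y) x
    -- (ii)
    ∧ (∀ k : ℕ, 2 ≤ k → k ≤ n - 1 →
        HasDerivAt (fun u => orderPDF f F n k u y)
          (f x / (1 - F x) * ((n : ℝ) - k + 1)
            * (orderPDF f F n k x y - orderPDF f F n (k - 1) x y)) x)
    -- in particular, the exponential case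
    ∧ (∀ x' y' : ℝ, 0 ≤ x' → x' < y' →
        HasDerivWithinAt (fun u => orderPDF expf expF n 1 u y')
            ((n : ℝ) * orderPDF expf expF n 1 x' y') (Set.Ici 0) x'
        ∧ ∀ k : ℕ, 2 ≤ k → k ≤ n - 1 →
            HasDerivWithinAt (fun u => orderPDF expf expF n k u y')
              (((n : ℝ) - k + 1)
                * (orderPDF expf expF n k x' y' - orderPDF expf expF n (k - 1) x' y'))
              (Set.Ici 0) x') := by
  have hne : 1 - F x ≠ 0 := by linarith
  have hw := hFdiff.hasDerivWithinAt (s := Set.univ)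
  refine ⟨?_, ?_, ?_⟩
  · exact hasDerivWithinAt_univ.1 (part_one f F _ x y hne hw n)
  · intro k hk hkn
    exact hasDerivWithinAt_univ.1 (part_two f F _ x y hne hw n k hk hkn)
  · intro x' y' hx' _
    have h1 : 1 - expF x' = Real.exp (-x') := by simp [expF, hx']
    have hne' : 1 - expF x' ≠ 0 := by rw [h1]; exact (Real.exp_pos _).ne'
    have hr : expf x' / (1 - expF x') = 1 := by
      rw [h1]; simp [expf, hx']
    refine ⟨?_, ?_⟩
    · have := part_one expf expF _ x' y' hne' (expF_deriv x' hx') n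
      rwa [hr, one_mul] at this
    · intro k hk hkn
      have := part_two expf expF _ x' y' hne' (expF_deriv x' hx') n k hk hkn
      rwa [hr, one_mul] at this
end

section
/- Let n, k be integers with 1 ≤ k ≤ n−1 and n ≥ k+1, and define the polynomial P_{n,k}(t) = ∏_{i=0}^{k−1}(n − i − t) / ∏_{i=0}^{k−1}(n − i). Then: (i) P_{n,k} is strictly decreasing on (−∞, n−k+1]; (ii) P_{n,k}(1) > (1 − k/n)² > P_{n,k}(2); (iii) consequently there is a unique real number β_{n,k} ∈ [1,2] with P_{n,k}(β_{n,k}) = (1 − k/n)²; and (iv) β_{n,k} < β_{n+1,k}, i.e. the sequence n ↦ β_{n,k} is strictly increasing. -/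
/-- The product after reflection, with `a = n - k`. -/
noncomputable def Qp (a : ℝ) (k : ℕ) (t : ℝ) : ℝ :=
  ∏ j ∈ Finset.range k, ((a + 1 + j - t) / (a + 1 + j))

theorem Qp_zero (a t : ℝ) : Qp a 0 t = 1 := by simp [Qp]

theorem Qp_succ (a : ℝ) (k : ℕ) (t : ℝ) :
    Qp a (k + 1) t = Qp a k t * ((a + 1 + k - t) / (a + 1 + k)) := by
  unfold Qp; rw [Finset.prod_range_succ]

theorem Qp_succ' (a : ℝ) (k : ℕ) (t : ℝ) :
    Qp a (k + 1) t = Qp (a + 1) k t * ((a + 1 - t) / (a + 1)) := by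
  unfold Qp
  rw [Finset.prod_range_succ']
  congr 1
  · apply Finset.prod_congr rfl
    intro j _
    push_cast
    congr 1 <;> ring
  · simp

theorem Qp_pos (a : ℝ) (ha : 1 ≤ a) (k : ℕ) (t : ℝ) (ht : t < a + 1) : 0 < Qp a k t := by
  apply Finset.prod_pos
  intro j _
  have : (0 : ℝ) ≤ j := j.cast_nonneg
  apply div_pos <;> linarith

theorem Qp_le (a : ℝ) (ha : 1 ≤ a) (k : ℕ) (s t : ℝ) (hst : s ≤ t) (ht : t ≤ a + 1) :
    Qp a k t ≤ Qp a k s := by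
  apply Finset.prod_le_prod
  · intro j _
    have : (0 : ℝ) ≤ j := j.cast_nonneg
    apply div_nonneg <;> linarith
  · intro j _
    have : (0 : ℝ) ≤ j := j.cast_nonneg
    apply div_le_div_of_nonneg_right <;> linarith

theorem Qp_anti (a : ℝ) (ha : 1 ≤ a) (k : ℕ) (hk : 1 ≤ k) :
    StrictAntiOn (Qp a k) (Set.Iic (a + 1)) := by
  intro s hs t ht hst
  simp only [Set.mem_Iic] at hs ht
  obtain ⟨m, rfl⟩ : ∃ m, k = m + 1 := ⟨k - 1, by omega⟩
  rw [Qp_succ, Qp_succ]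
  have hm : (0 : ℝ) ≤ m := m.cast_nonneg
  have h1 := Qp_le a ha m s t hst.le ht
  have h2 := Qp_pos a ha m s (by linarith)
  have h3 : 0 ≤ (a + 1 + m - t) / (a + 1 + m) := by apply div_nonneg <;> linarith
  have h4 : (a + 1 + m - t) / (a + 1 + m) < (a + 1 + m - s) / (a + 1 + m) := by
    apply div_lt_div_of_pos_right <;> linarith
  calc _ ≤ Qp a m s * ((a + 1 + m - t) / (a + 1 + m)) := mul_le_mul_of_nonneg_right h1 h3
    _ < _ := mul_lt_mul_of_pos_left h4 h2

theorem Qp_one (a : ℝ) (ha : 1 ≤ a) (k : ℕ) : Qp a k 1 = a / (a + k) := by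
  induction k with
  | zero => rw [Qp_zero]; have : a ≠ 0 := by linarith
            simp [this]
  | succ m ih =>
    have hm : (0 : ℝ) ≤ m := m.cast_nonneg
    rw [Qp_succ, ih]
    push_cast
    have h1 : a + m ≠ 0 := by linarith
    have h2 : a + 1 + m ≠ 0 := by linarith
    have h3 : a + (m + 1) ≠ 0 := by linarith
    field_simp
    ring

theorem Qp_two (a : ℝ) (ha : 1 ≤ a) (k : ℕ) :
    Qp a k 2 * ((a + k) * (a + k - 1)) = a * (a - 1) := by
  induction k with
  | zero => rw [Qp_zero]; simp
  | succ m ih =>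
    have hm : (0 : ℝ) ≤ m := m.cast_nonneg
    rw [Qp_succ, ← ih]
    push_cast
    have h2 : a + 1 + m ≠ 0 := by linarith
    field_simp
    ring

/-- threshold -/
noncomputable def dl (a n : ℝ) : ℝ := a * n / (a * n + a + n)

theorem dl_facts (a n : ℝ) (ha : 1 ≤ a) (hn : a ≤ n) :
    0 < dl a n ∧ dl a n < 1 ∧ dl a n < dl a (n + 1) ∧
    (dl a (n + 1) - dl a n) / (a - dl a n) = dl a (n + 1) / (a * (n + 1) ^ 2) := by
  have h0 : 0 < a * n := by nlinarith
  have hD : 0 < a * n + a + n := by nlinarith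
  have hD' : 0 < a * (n + 1) + a + (n + 1) := by nlinarith
  have hE : a * (n + 1) + n ≠ 0 := by nlinarith
  have hE' : a * (n + 1 + 1) + (n + 1) ≠ 0 := by nlinarith
  have e1 : a - dl a n = a ^ 2 * (n + 1) / (a * n + a + n) := by
    unfold dl; field_simp; ring
  have e2 : dl a (n + 1) - dl a n = a ^ 2 / ((a * n + a + n) * (a * (n + 1) + a + (n + 1))) := by
    unfold dl; field_simp; ring
  refine ⟨by unfold dl; positivity, ?_, ?_, ?_⟩
  · unfold dl; rw [div_lt_one hD]; linarith
  · have : 0 < dl a (n + 1) - dl a n := by rw [e2]; positivity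
    linarith
  · rw [e1, e2]; unfold dl
    have : n + 1 ≠ 0 := by linarith
    have : a ≠ 0 := by linarith
    field_simp

theorem step_ineq (a d : ℝ) (ha : 1 ≤ a) (hd : 0 ≤ d) :
    1 < (1 - d * (dl a (a + d + 1) / (a * (a + d + 1) ^ 2))) *
      ((1 - dl a (a + d + 1) / (a + d)) * ((a + d + 1) / (a + d))) := by
  obtain ⟨b, rfl⟩ : ∃ b, a = b + 1 := ⟨a - 1, by ring⟩
  have hb : 0 ≤ b := by linarith
  unfold dl
  rw [← sub_pos]
  have hD : 0 < (b + 1) * (b + 1 + d + 1) + (b + 1) + (b + 1 + d + 1) := by positivity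
  have hn : 0 < b + 1 + d := by positivity
  have hb1 : 0 < b + 1 := by positivity
  field_simp
  ring_nf
  positivity

/-- `R a d δ = ∏_{j<d} (1 - δ/(a+j))` -/
noncomputable def Rp (a : ℝ) (d : ℕ) (δ : ℝ) : ℝ :=
  ∏ j ∈ Finset.range d, ((a + j - δ) / (a + j))

theorem Rp_bern (a : ℝ) (ha : 1 ≤ a) (d : ℕ) (δ δ' : ℝ) (h0 : 0 < δ) (h1 : δ ≤ δ') (h2 : δ' < 1) :
    Rp a d δ * (1 - d * ((δ' - δ) / (a - δ))) ≤ Rp a d δ' := by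
  induction d with
  | zero => simp [Rp]
  | succ m ih =>
    have hm : (0 : ℝ) ≤ m := m.cast_nonneg
    have hs : ∀ x, Rp a (m + 1) x = Rp a m x * ((a + m - x) / (a + m)) := by
      intro x; unfold Rp; rw [Finset.prod_range_succ]
    rw [hs, hs]
    have hR : 0 ≤ Rp a m δ := by
      apply Finset.prod_nonneg
      intro j _
      have : (0 : ℝ) ≤ j := j.cast_nonneg
      apply div_nonneg <;> linarith
    set x := (δ' - δ) / (a - δ) with hx
    have hx0 : 0 ≤ x := by apply div_nonneg <;> linarith
    have hxe : x * (a - δ) = δ' - δ := by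
      rw [hx]; apply div_mul_cancel₀; linarith
    have hf : (a + m - δ) / (a + m) * (1 - x) ≤ (a + m - δ') / (a + m) := by
      rw [div_mul_eq_mul_div]
      apply div_le_div_of_nonneg_right _ (by linarith)
      nlinarith
    have hf0 : 0 ≤ (a + m - δ') / (a + m) := by apply div_nonneg <;> linarith
    have hg0 : 0 ≤ (a + m - δ) / (a + m) := by apply div_nonneg <;> linarith
    have hx1 : x ≤ 1 := by rw [hx, div_le_one (by linarith)]; linarith
    push_cast
    have hB : 1 - (m + 1) * x ≤ (1 - m * x) * (1 - x) := by nlinarith [mul_nonneg hm (mul_nonneg hx0 hx0)]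
    have hfx : 0 ≤ (a + m - δ) / (a + m) * (1 - x) := mul_nonneg hg0 (by linarith)
    have hR' : 0 ≤ Rp a m δ' := by
      apply Finset.prod_nonneg
      intro j _
      have : (0 : ℝ) ≤ j := j.cast_nonneg
      apply div_nonneg <;> linarith
    calc _ ≤ Rp a m δ * ((a + m - δ) / (a + m)) * ((1 - m * x) * (1 - x)) :=
          mul_le_mul_of_nonneg_left hB (mul_nonneg hR hg0)
      _ = (Rp a m δ * (1 - m * x)) * ((a + m - δ) / (a + m) * (1 - x)) := by ring
      _ ≤ Rp a m δ' * ((a + m - δ) / (a + m) * (1 - x)) := mul_le_mul_of_nonneg_right ih hfx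
      _ ≤ _ := mul_le_mul_of_nonneg_left hf hR'

theorem Rp_step (a : ℝ) (ha : 1 ≤ a) (d : ℕ) (ih : a / (a + d) ≤ Rp a d (dl a (a + d))) :
    a / (a + (d + 1 : ℕ)) < Rp a (d + 1) (dl a (a + (d + 1 : ℕ))) := by
  have hd : (0 : ℝ) ≤ d := d.cast_nonneg
  obtain ⟨f1, f2, f3, f4⟩ := dl_facts a (a + d) ha (by linarith)
  obtain ⟨g1, g2, -, -⟩ := dl_facts a (a + d + 1) ha (by linarith)
  have hs := step_ineq a d ha hd
  have hB := Rp_bern a ha d _ _ f1 f3.le g2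
  rw [f4] at hB
  have e : a + ((d + 1 : ℕ) : ℝ) = a + d + 1 := by push_cast; ring
  rw [e]
  set δ' := dl a (a + d + 1)
  have hR : Rp a (d + 1) δ' = Rp a d δ' * ((a + d - δ') / (a + d)) := by
    unfold Rp; rw [Finset.prod_range_succ]
  rw [hR]
  set y := 1 - d * (δ' / (a * (a + d + 1) ^ 2))
  have hn : 0 < a + d := by linarith
  have hz : 0 < (a + d - δ') / (a + d) := by apply div_pos <;> linarith
  have e2 : (1 - δ' / (a + d)) = (a + d - δ') / (a + d) := by field_simp
  rw [e2] at hs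
  set z := (a + d - δ') / (a + d)
  have hc : 0 < (a + d + 1) / (a + d) := by positivity
  have hy : 0 < y := by
    by_contra h
    have := mul_nonneg (neg_nonneg.2 (not_lt.1 h)) (mul_pos hz hc).le
    linarith
  have ha0 : 0 < a := by linarith
  calc a / (a + d + 1) = a / (a + d + 1) * 1 := by ring
    _ < a / (a + d + 1) * (y * (z * ((a + d + 1) / (a + d)))) :=
        mul_lt_mul_of_pos_left hs (by positivity)
    _ = a / (a + d) * y * z := by field_simp
    _ ≤ Rp a d (dl a (a + d)) * y * z := by gcongr
    _ ≤ _ := by gcongr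

theorem Rp_le (a : ℝ) (ha : 1 ≤ a) (d : ℕ) : a / (a + d) ≤ Rp a d (dl a (a + d)) := by
  induction d with
  | zero =>
    have : a ≠ 0 := by linarith
    simp [Rp, this]
  | succ m ih => exact (Rp_step a ha m ih).le

theorem Rp_lt (a : ℝ) (ha : 1 ≤ a) (k : ℕ) (hk : 1 ≤ k) :
    a / (a + k) < Rp a k (dl a (a + k)) := by
  obtain ⟨m, rfl⟩ : ∃ m, k = m + 1 := ⟨k - 1, by omega⟩
  exact Rp_step a ha m (Rp_le a ha m)

theorem Qp_Rp (a : ℝ) (ha : 1 ≤ a) (k : ℕ) (δ : ℝ) :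
    Qp a k (1 + δ) = a / (a + k) * Rp a k δ := by
  rw [← Qp_one a ha]
  unfold Qp Rp
  rw [← Finset.prod_mul_distrib]
  apply Finset.prod_congr rfl
  intro j _
  have : (0 : ℝ) ≤ j := j.cast_nonneg
  have h1 : a + 1 + j ≠ 0 := by linarith
  have h2 : a + j ≠ 0 := by linarith
  have h3 : a + 1 + j - 1 = a + j := by ring
  rw [h3]
  field_simp
  ring

theorem Qp_next (a : ℝ) (ha : 1 ≤ a) (k : ℕ) (hk : 1 ≤ k) (β : ℝ)
    (h1 : 1 + dl a (a + k) < β) (h2 : β < 2) (h : Qp a k β = (a / (a + k)) ^ 2) :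
    ((a + 1) / (a + 1 + k)) ^ 2 < Qp (a + 1) k β := by
  have hk' : (1 : ℝ) ≤ k := by exact_mod_cast hk
  have e := (Qp_succ' a k β).symm.trans (Qp_succ a k β)
  rw [h] at e
  set m : ℝ := (k : ℝ)
  have hw : 0 < (a + 1 - β) / (a + 1) := by apply div_pos <;> linarith
  refine lt_of_mul_lt_mul_right ?_ hw.le
  rw [e]
  have hD : 0 < a * (a + m) + a + (a + m) := by nlinarith
  have h3 : a * (a + m) < (β - 1) * (a * (a + m) + a + (a + m)) := by
    rw [← div_lt_iff₀ hD]; unfold dl at h1; linarith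
  have ha0 : 0 < a := by linarith
  have hm0 : 0 < m := by linarith
  rw [← sub_pos]
  have key : (a / (a + m)) ^ 2 * ((a + 1 + m - β) / (a + 1 + m)) -
      ((a + 1) / (a + 1 + m)) ^ 2 * ((a + 1 - β) / (a + 1)) =
      m * ((β - 1) * (a * (a + m) + a + (a + m)) - a * (a + m)) /
        ((a + m) ^ 2 * (a + 1 + m) ^ 2) := by
    field_simp
    ring
  rw [key]
  apply div_pos
  · apply mul_pos hm0; linarith
  · positivity

theorem P_eq_Qp (a k : ℕ) (t : ℝ) :
    (∏ i ∈ Finset.range k, (((a + k : ℕ) : ℝ) - i - t)) /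
      ∏ i ∈ Finset.range k, (((a + k : ℕ) : ℝ) - i) = Qp a k t := by
  rw [← Finset.prod_div_distrib, ← Finset.prod_range_reflect]
  unfold Qp
  apply Finset.prod_congr rfl
  intro j hj
  have hj := Finset.mem_range.1 hj
  have : ((k - 1 - j : ℕ) : ℝ) = k - 1 - j := by
    rw [Nat.cast_sub (by omega), Nat.cast_sub (by omega)]; simp
  rw [this]
  push_cast
  congr 1 <;> ring

/-- Properties of `P_{n,k}(t) = ∏_{i<k}(n−i−t)/∏_{i<k}(n−i)`:
it is strictly decreasing on `(−∞, n−k+1]`, satisfies `P_{n,k}(1) > (1−k/n)² > P_{n,k}(2)`,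
hence has a unique root `β_{n,k} ∈ [1,2]` of `P_{n,k}(β) = (1−k/n)²`, and `β_{n,k} < β_{n+1,k}`. -/
theorem stmt_11 (n k : ℕ) (hk : 1 ≤ k) (hkn : k + 1 ≤ n)
    (P : ℕ → ℝ → ℝ)
    (hP : ∀ (m : ℕ) (t : ℝ), P m t
      = (∏ i ∈ Finset.range k, ((m : ℝ) - i - t)) / ∏ i ∈ Finset.range k, ((m : ℝ) - i)) :
    -- (i)
    StrictAntiOn (P n) (Set.Iic ((n : ℝ) - k + 1))
    -- (ii)
    ∧ ((1 - (k : ℝ) / n) ^ 2 < P n 1 ∧ P n 2 < (1 - (k : ℝ) / n) ^ 2)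
    -- (iii)
    ∧ (∃! β : ℝ, β ∈ Set.Icc (1 : ℝ) 2 ∧ P n β = (1 - (k : ℝ) / n) ^ 2)
    -- (iv)
    ∧ (∀ β β' : ℝ, β ∈ Set.Icc (1 : ℝ) 2 → P n β = (1 - (k : ℝ) / n) ^ 2 →
        β' ∈ Set.Icc (1 : ℝ) 2 → P (n + 1) β' = (1 - (k : ℝ) / (n + 1)) ^ 2 → β < β') := by
  obtain ⟨a, rfl⟩ : ∃ a, n = a + k := ⟨n - k, by omega⟩
  have ha : (1 : ℝ) ≤ a := by exact_mod_cast (by omega : 1 ≤ a)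
  have hk' : (1 : ℝ) ≤ k := by exact_mod_cast hk
  have hPn : P (a + k) = Qp a k := by
    funext t; rw [hP, P_eq_Qp]
  have hPn' : P (a + k + 1) = Qp (a + 1) k := by
    funext t
    have := P_eq_Qp (a + 1) k t
    rw [hP, show a + k + 1 = a + 1 + k by ring, this]
    push_cast; rfl
  have hc : (1 - (k : ℝ) / ((a + k : ℕ) : ℝ)) = a / (a + k) := by
    push_cast
    have : (a : ℝ) + k ≠ 0 := by linarith
    field_simp; ring
  have hc' : (1 - (k : ℝ) / (((a + k : ℕ) : ℝ) + 1)) = (a + 1) / (a + 1 + k) := by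
    push_cast
    have : (a : ℝ) + k + 1 ≠ 0 := by linarith
    have : (a : ℝ) + 1 + k ≠ 0 := by linarith
    field_simp; ring
  have hI : ((a + k : ℕ) : ℝ) - k + 1 = a + 1 := by push_cast; ring
  rw [hPn, hPn', hc, hc', hI]
  have anti := Qp_anti a ha k hk
  have h1 : ((a : ℝ) / (a + k)) ^ 2 < Qp a k 1 := by
    rw [Qp_one _ ha]
    have p : 0 < (a : ℝ) / (a + k) := by apply div_pos <;> linarith
    have q : (a : ℝ) / (a + k) < 1 := by rw [div_lt_one] <;> linarith
    nlinarith
  have h2 : Qp a k 2 < ((a : ℝ) / (a + k)) ^ 2 := by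
    have e := Qp_two a ha k
    have hp : 0 < ((a : ℝ) + k) * (a + k - 1) := by apply mul_pos <;> linarith
    rw [← eq_div_iff hp.ne'] at e
    rw [e, div_pow, div_lt_div_iff₀ hp (by positivity)]
    have : 0 < (a : ℝ) * (a + k) * k := by positivity
    nlinarith
  refine ⟨anti, ⟨h1, h2⟩, ?_, ?_⟩
  · have hcont : Continuous (Qp a k) := by
      unfold Qp
      fun_prop
    obtain ⟨β, hβ, e⟩ := intermediate_value_Icc' (by norm_num : (1 : ℝ) ≤ 2) hcont.continuousOn
      ⟨h2.le, h1.le⟩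
    refine ⟨β, ⟨hβ, e⟩, ?_⟩
    rintro γ ⟨hγ, e'⟩
    refine anti.injOn ?_ ?_ (e'.trans e.symm)
    · simp only [Set.mem_Iic]; linarith [hγ.2]
    · simp only [Set.mem_Iic]; linarith [hβ.2]
  · intro β β' hβ e hβ' e'
    obtain ⟨d0, d1, -, -⟩ := dl_facts a (a + k) ha (by linarith)
    have b2 : β < 2 := by
      rcases hβ.2.lt_or_eq with h | h
      · exact h
      · rw [h] at e; linarith
    have b1 : 1 + dl a (a + k) < β := by
      rw [← anti.lt_iff_gt (a := β) (b := 1 + dl a (a + k))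
        (by simp only [Set.mem_Iic]; linarith) (by simp only [Set.mem_Iic]; linarith), e,
        Qp_Rp _ ha, sq]
      apply mul_lt_mul_of_pos_left (Rp_lt _ ha k hk)
      apply div_pos <;> linarith
    have := Qp_next a ha k hk β b1 b2 e
    rw [← e'] at this
    refine ((Qp_anti (a + 1) (by linarith) k hk).lt_iff_gt ?_ ?_).1 this
    · simp only [Set.mem_Iic]; linarith [hβ'.2]
    · simp only [Set.mem_Iic]; linarith
end

section
/- Let k ≥ 1 be a fixed integer. For each integer n ≥ k+1 let β_{n,k} be the unique root in [1,2] of the equation ∏_{i=0}^{k−1}(n − i − t) / ∏_{i=0}^{k−1}(n − i) = (1 − k/n)². Then, as n → ∞, n²·( β_{n,k} − 2 + 1/n ) → −(k−1)/2; that is, β_{n,k} = 2 − 1/n − (k−1)/(2n²) + o(1/n²). -/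
theorem auxP (k : ℕ) : ∃ R : ℝ → ℝ, Continuous R ∧ ∀ x : ℝ,
    ∏ i ∈ Finset.range k, (1 - i * x - (2 - x) * x) =
      1 + ((-3/2)*(k:ℝ)^1 + (-1/2)*(k:ℝ)^2) * x
      + ((-1/12)*(k:ℝ)^1 + (3/8)*(k:ℝ)^2 + (7/12)*(k:ℝ)^3 + (1/8)*(k:ℝ)^4) * x ^ 2
      + ((1/2)*(k:ℝ)^1 + (-11/24)*(k:ℝ)^2 + (5/48)*(k:ℝ)^3 + (-1/48)*(k:ℝ)^4
        + (-5/48)*(k:ℝ)^5 + (-1/48)*(k:ℝ)^6) * x ^ 3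
      + x ^ 4 * R x := by
  induction k with
  | zero => exact ⟨fun _ => 0, continuous_const, fun x => by simp⟩
  | succ k ih =>
    obtain ⟨R, hR, h⟩ := ih
    refine ⟨fun x => R x * (1 - (k + 2) * x + x ^ 2)
      + ((1/2)*(k:ℝ)^1 + (-11/24)*(k:ℝ)^2 + (5/48)*(k:ℝ)^3 + (-1/48)*(k:ℝ)^4
        + (-5/48)*(k:ℝ)^5 + (-1/48)*(k:ℝ)^6) * (-(k + 2) + x)
      + ((-1/12)*(k:ℝ)^1 + (3/8)*(k:ℝ)^2 + (7/12)*(k:ℝ)^3 + (1/8)*(k:ℝ)^4),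
      by fun_prop, fun x => ?_⟩
    rw [Finset.prod_range_succ, h]
    push_cast
    ring

theorem auxQ (k : ℕ) : ∃ R : ℝ → ℝ, Continuous R ∧ ∀ x : ℝ,
    ∏ i ∈ Finset.range k, (1 - i * x) =
      1 + ((1/2)*(k:ℝ)^1 + (-1/2)*(k:ℝ)^2) * x
      + ((-1/12)*(k:ℝ)^1 + (3/8)*(k:ℝ)^2 + (-5/12)*(k:ℝ)^3 + (1/8)*(k:ℝ)^4) * x ^ 2
      + ((-1/8)*(k:ℝ)^2 + (17/48)*(k:ℝ)^3 + (-17/48)*(k:ℝ)^4 + (7/48)*(k:ℝ)^5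
        + (-1/48)*(k:ℝ)^6) * x ^ 3
      + x ^ 4 * R x := by
  induction k with
  | zero => exact ⟨fun _ => 0, continuous_const, fun x => by simp⟩
  | succ k ih =>
    obtain ⟨R, hR, h⟩ := ih
    refine ⟨fun x => R x * (1 - k * x)
      - k * ((-1/8)*(k:ℝ)^2 + (17/48)*(k:ℝ)^3 + (-17/48)*(k:ℝ)^4 + (7/48)*(k:ℝ)^5
        + (-1/48)*(k:ℝ)^6),
      by fun_prop, fun x => ?_⟩
    rw [Finset.prod_range_succ, h]
    push_cast
    ring

theorem auxF (k : ℕ) : ∃ T : ℝ → ℝ, Continuous T ∧ ∀ x : ℝ,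
    ∏ i ∈ Finset.range k, (1 - i * x - (2 - x) * x)
      - (1 - k * x) ^ 2 * ∏ i ∈ Finset.range k, (1 - i * x) =
      x ^ 3 * (-(k * (k - 1)) / 2 + x * T x) := by
  obtain ⟨R, hR, h⟩ := auxP k
  obtain ⟨S, hS, h'⟩ := auxQ k
  refine ⟨fun x => R x - ((1 - k * x) ^ 2 * S x
    + ((-1/12)*(k:ℝ)^1 + (3/8)*(k:ℝ)^2 + (-5/12)*(k:ℝ)^3 + (1/8)*(k:ℝ)^4) * k ^ 2
    + ((-1/8)*(k:ℝ)^2 + (17/48)*(k:ℝ)^3 + (-17/48)*(k:ℝ)^4 + (7/48)*(k:ℝ)^5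
        + (-1/48)*(k:ℝ)^6) * (k ^ 2 * x - 2 * k)), by fun_prop, fun x => ?_⟩
  rw [h, h']
  ring

theorem auxG (k : ℕ) : ∃ G : ℝ × ℝ → ℝ, Continuous G ∧ G (0, 0) = k ∧ ∀ x h : ℝ,
    ∏ i ∈ Finset.range k, (1 - i * x - (2 - x) * x + h) =
    ∏ i ∈ Finset.range k, (1 - i * x - (2 - x) * x) + h * G (x, h) := by
  induction k with
  | zero => exact ⟨fun _ => 0, continuous_const, by simp, fun x h => by simp⟩
  | succ k ih =>
    obtain ⟨G, hG, h0, hh⟩ := ih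
    refine ⟨fun p => G p * (1 - k * p.1 - (2 - p.1) * p.1 + p.2)
      + ∏ i ∈ Finset.range k, (1 - i * p.1 - (2 - p.1) * p.1), by fun_prop, by simp [h0],
      fun x h => ?_⟩
    rw [Finset.prod_range_succ, Finset.prod_range_succ, hh]
    ring

/-- Asymptotic expansion of the root `β_{n,k} ∈ [1,2]` of
`∏_{i<k}(n−i−t)/∏_{i<k}(n−i) = (1−k/n)²`: one has
`β_{n,k} = 2 − 1/n − (k−1)/(2n²) + o(1/n²)`, i.e. `n²(β_{n,k} − 2 + 1/n) → −(k−1)/2`. -/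
theorem stmt_12 (k : ℕ) (hk : 1 ≤ k) (β : ℕ → ℝ)
    (hβ : ∀ n : ℕ, k + 1 ≤ n →
      β n ∈ Set.Icc (1 : ℝ) 2 ∧
      (∏ i ∈ Finset.range k, ((n : ℝ) - i - β n)) / (∏ i ∈ Finset.range k, ((n : ℝ) - i))
        = (1 - (k : ℝ) / n) ^ 2) :
    Filter.Tendsto (fun n : ℕ => (n : ℝ) ^ 2 * (β n - 2 + 1 / n)) Filter.atTop
      (nhds (-((k : ℝ) - 1) / 2)) := by
  obtain ⟨T, hT, hF⟩ := auxF k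
  obtain ⟨G, hG, hG0, hGe⟩ := auxG k
  have hk0 : (k : ℝ) ≠ 0 := by positivity
  have hx : Filter.Tendsto (fun n : ℕ => 1 / (n : ℝ)) Filter.atTop (nhds 0) :=
    tendsto_one_div_atTop_nhds_zero_nat
  have hh : Filter.Tendsto (fun n : ℕ => -(β n - 2 + 1 / n) * (1 / (n : ℝ)))
      Filter.atTop (nhds 0) := by
    refine squeeze_zero_norm' ?_ hx
    filter_upwards [Filter.eventually_ge_atTop (k + 1)] with n hn
    obtain ⟨⟨h1, h2⟩, -⟩ := hβ n hn
    have hn1 : (1 : ℝ) ≤ n := by exact_mod_cast (by omega : 1 ≤ n)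
    have h3 : 1 / (n : ℝ) ≤ 1 := by rw [div_le_one (by linarith)]; exact hn1
    have h4 : 0 ≤ 1 / (n : ℝ) := by positivity
    rw [norm_mul, Real.norm_eq_abs, Real.norm_eq_abs, abs_of_nonneg h4]
    refine mul_le_of_le_one_left h4 ?_
    rw [abs_le]
    constructor <;> linarith
  have hGl : Filter.Tendsto
      (fun n : ℕ => G (1 / (n : ℝ), -(β n - 2 + 1 / n) * (1 / (n : ℝ))))
      Filter.atTop (nhds (k : ℝ)) := by
    rw [← hG0]
    exact (hG.tendsto (0, 0)).comp (hx.prodMk_nhds hh)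
  have hTl : Filter.Tendsto
      (fun n : ℕ => -((k : ℝ) * (k - 1)) / 2 + 1 / (n : ℝ) * T (1 / (n : ℝ)))
      Filter.atTop (nhds (-((k : ℝ) * (k - 1)) / 2)) := by
    have := (hx.mul ((hT.tendsto 0).comp hx)).const_add (-((k : ℝ) * (k - 1)) / 2)
    simpa using this
  have hlim := hTl.div hGl hk0
  have hc : -((k : ℝ) * (k - 1)) / 2 / k = -((k : ℝ) - 1) / 2 := by field_simp
  rw [hc] at hlim
  refine hlim.congr' ?_
  filter_upwards [Filter.eventually_ge_atTop (k + 1), hGl.eventually_ne hk0] with n hn hne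
  obtain ⟨-, he⟩ := hβ n hn
  have hn0 : (n : ℝ) ≠ 0 := by
    have : n ≠ 0 := by omega
    exact_mod_cast this
  have e1 : ∏ i ∈ Finset.range k, ((n : ℝ) - i - β n) =
      (n : ℝ) ^ k * ∏ i ∈ Finset.range k, (1 - i * (1 / (n : ℝ)) - (2 - 1 / (n : ℝ)) * (1 / (n : ℝ))
        + -(β n - 2 + 1 / n) * (1 / (n : ℝ))) := by
    have hp : (n : ℝ) ^ k = ∏ _i ∈ Finset.range k, (n : ℝ) := by simp
    rw [hp, ← Finset.prod_mul_distrib]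
    refine Finset.prod_congr rfl fun i _ => ?_
    field_simp
    ring
  have e2 : ∏ i ∈ Finset.range k, ((n : ℝ) - i) =
      (n : ℝ) ^ k * ∏ i ∈ Finset.range k, (1 - i * (1 / (n : ℝ))) := by
    have hp : (n : ℝ) ^ k = ∏ _i ∈ Finset.range k, (n : ℝ) := by simp
    rw [hp, ← Finset.prod_mul_distrib]
    refine Finset.prod_congr rfl fun i _ => ?_
    field_simp
  have hQ : ∏ i ∈ Finset.range k, ((n : ℝ) - i) ≠ 0 := by
    rw [Finset.prod_ne_zero_iff]
    intro i hi
    have : (i : ℝ) < n := by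
      have := Finset.mem_range.1 hi
      exact_mod_cast (by omega : i < n)
    linarith
  rw [div_eq_iff hQ, e1, e2, hGe] at he
  have hF' := hF (1 / (n : ℝ))
  have hnk : (n : ℝ) ^ k ≠ 0 := pow_ne_zero _ hn0
  rw [mul_left_comm] at he
  have he' := mul_left_cancel₀ hnk he
  have hkn : (k : ℝ) / n = k * (1 / n) := by ring
  rw [hkn] at he'
  simp only [Pi.div_apply]
  rw [div_eq_iff hne]
  have key : (1 / (n : ℝ)) ^ 3 * (-((k : ℝ) * (k - 1)) / 2 + 1 / (n : ℝ) * T (1 / (n : ℝ))) =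
      (β n - 2 + 1 / n) * (1 / (n : ℝ)) *
        G (1 / (n : ℝ), -(β n - 2 + 1 / n) * (1 / (n : ℝ))) := by
    linarith
  generalize G (1 / (n : ℝ), -(β n - 2 + 1 / n) * (1 / (n : ℝ))) = g at *
  generalize -((k : ℝ) * (k - 1)) / 2 + 1 / (n : ℝ) * T (1 / (n : ℝ)) = c at *
  generalize β n - 2 + 1 / (n : ℝ) = u at *
  field_simp at key
  linarith
end
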